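/- arXiv:1605.08819 — 2 statements merged into one kernel-verified Lean document; each statement's English description precedes it below -/
import Mathlib

section
/- For every integer n ≥ 1 and every real number α with α ≠ 0 and α ≠ −1, ((α+1)^n / α) · A_n(α/(α+1)) = ∑_{k=1}^{n} S(n,k) · k! · α^{k−1}, where A_n is the Eulerian polynomial. -/
def finLo {N : ℕ} (i : Fin (N - 1)) : Fin N := ⟨i.val, by have := i.isLt; omega⟩
def finHi {N : ℕ} (i : Fin (N - 1)) : Fin N := ⟨i.val + 1, by have := i.isLt; omega⟩

/-- The number of descents of a permutation of `Fin N`: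
`d(π) = #{i : π(i) > π(i+1)}`. -/
def descents {N : ℕ} (π : Equiv.Perm (Fin N)) : ℕ :=
  (Finset.univ.filter fun i : Fin (N - 1) => π (finHi i) < π (finLo i)).card

/-- Stirling numbers of the second kind. -/
def stirling : ℕ → ℕ → ℕ
  | 0, 0 => 1
  | 0, _ + 1 => 0
  | _ + 1, 0 => 0
  | n + 1, k + 1 => (k + 1) * stirling n (k + 1) + stirling n k

section

open Finset Polynomial

/-- The permutation of `Fin (n + 1)` obtained from `π` by inserting the largest value at
position `p`. -/
def insertLast {n : ℕ} (p : Fin (n + 1)) (π : Equiv.Perm (Fin n)) : Equiv.Perm (Fin (n + 1)) :=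
  (finSuccEquiv' p).trans ((Equiv.optionCongr π).trans (finSuccEquiv' (Fin.last n)).symm)

theorem insertLast_self {n : ℕ} (p : Fin (n + 1)) (π : Equiv.Perm (Fin n)) :
    insertLast p π p = Fin.last n := by
  simp [insertLast]

theorem insertLast_succAbove {n : ℕ} (p : Fin (n + 1)) (π : Equiv.Perm (Fin n)) (i : Fin n) :
    insertLast p π (p.succAbove i) = (π i).castSucc := by
  simp [insertLast]

theorem insertLast_bijective (n : ℕ) :
    Function.Bijective fun x : Fin (n + 1) × Equiv.Perm (Fin n) => insertLast x.1 x.2 := by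
  rw [Fintype.bijective_iff_injective_and_card]
  constructor
  · rintro ⟨p, π⟩ ⟨q, σ⟩ h
    simp only at h
    obtain rfl : p = q := by
      apply (insertLast p π).injective
      rw [insertLast_self, h, insertLast_self]
    congr 1
    ext i
    have := congrArg (fun τ => (τ (p.succAbove i)).val) h
    simpa [insertLast_succAbove] using this
  · simp [Fintype.card_perm, Nat.factorial_succ]

/-- The one-line notation of `π`, extended by `0`. -/
def permSeq {n : ℕ} (π : Equiv.Perm (Fin n)) (i : ℕ) : ℕ :=
  if h : i < n then (π ⟨i, h⟩ : ℕ) else 0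

theorem permSeq_lt {n : ℕ} (π : Equiv.Perm (Fin (n + 1))) (i : ℕ) : permSeq π i < n + 1 := by
  unfold permSeq
  split_ifs <;> omega

theorem descents_eq_sum {m : ℕ} (π : Equiv.Perm (Fin (m + 1))) :
    descents π = ∑ i ∈ range m, if permSeq π (i + 1) < permSeq π i then 1 else 0 := by
  unfold descents
  rw [card_filter, sum_range]
  refine sum_congr rfl fun i _ => ?_
  have hi : (i : ℕ) < m := i.isLt
  have h1 : (i : ℕ) < m + 1 := by omega
  rw [permSeq, permSeq, dif_pos h1, dif_pos (show (i : ℕ) + 1 < m + 1 by omega)]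
  rfl

theorem descents_le {m : ℕ} (π : Equiv.Perm (Fin (m + 1))) : descents π ≤ m := by
  simpa [descents] using card_filter_le (univ : Finset (Fin m)) _

theorem permSeq_insertLast_of_lt {n : ℕ} (p : Fin (n + 1)) (π : Equiv.Perm (Fin n)) {i : ℕ}
    (hi : i < p) : permSeq (insertLast p π) i = permSeq π i := by
  have hp := p.isLt
  have h1 : i < n := by omega
  have h2 : i < n + 1 := by omega
  have h := insertLast_succAbove p π ⟨i, h1⟩
  rw [Fin.succAbove_of_castSucc_lt _ _ (by simpa [Fin.lt_def] using hi)] at h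
  simpa [permSeq, h1, h2] using congrArg Fin.val h

theorem permSeq_insertLast_self {n : ℕ} (p : Fin (n + 1)) (π : Equiv.Perm (Fin n)) :
    permSeq (insertLast p π) p = n := by
  simp [permSeq, insertLast_self, p.is_le]

theorem permSeq_insertLast_succ {n : ℕ} (p : Fin (n + 1)) (π : Equiv.Perm (Fin n)) {i : ℕ}
    (hi : p ≤ i) : permSeq (insertLast p π) (i + 1) = permSeq π i := by
  by_cases h1 : i < n
  · have h := insertLast_succAbove p π ⟨i, h1⟩
    rw [Fin.succAbove_of_le_castSucc _ _ (by simpa [Fin.le_def] using hi)] at h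
    simpa [permSeq, h1] using congrArg Fin.val h
  · simp [permSeq, h1]

theorem descents_insertLast_last {m : ℕ} (π : Equiv.Perm (Fin (m + 1))) :
    descents (insertLast (Fin.last (m + 1)) π) = descents π := by
  have hs := permSeq_insertLast_self (Fin.last (m + 1)) π
  have hl := permSeq_insertLast_of_lt (Fin.last (m + 1)) π (i := m) (by simp)
  simp only [Fin.val_last] at hs
  have hlt := permSeq_lt π m
  rw [descents_eq_sum, descents_eq_sum, sum_range_succ, hs, hl, if_neg (by omega), add_zero]
  refine sum_congr rfl fun i hi => ?_
  have him := mem_range.1 hi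
  rw [permSeq_insertLast_of_lt _ _ (by simp; omega), permSeq_insertLast_of_lt _ _ (by simp; omega)]

theorem descents_insertLast_zero {m : ℕ} (π : Equiv.Perm (Fin (m + 1))) :
    descents (insertLast 0 π) = descents π + 1 := by
  have hs := permSeq_insertLast_self 0 π
  have hl (i : ℕ) := permSeq_insertLast_succ 0 π (i := i) (by simp)
  simp only [Fin.val_zero] at hs
  have hlt := permSeq_lt π 0
  rw [descents_eq_sum, descents_eq_sum, sum_range_succ', hl, hs, if_pos hlt]
  simp only [hl]

theorem descents_insertLast_castSucc_succ {m : ℕ} (π : Equiv.Perm (Fin (m + 1))) (q : Fin m) :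
    descents (insertLast q.succ.castSucc π) =
      if π q.succ < π q.castSucc then descents π else descents π + 1 := by
  set p : Fin (m + 2) := q.succ.castSucc with hp
  have hpv : (p : ℕ) = q + 1 := by simp [hp]
  have hs := permSeq_insertLast_self p π
  have hl (i : ℕ) (hi : q + 1 ≤ i) := permSeq_insertLast_succ p π (i := i) (by omega)
  have hlo (i : ℕ) (hi : i < q + 1) := permSeq_insertLast_of_lt p π (i := i) (by omega)
  have hq : π q.succ < π q.castSucc ↔ permSeq π (q + 1) < permSeq π q := by
    have h1 : (q : ℕ) < m + 1 := by omega
    have h2 : (q : ℕ) + 1 < m + 1 := by omega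
    rw [permSeq, permSeq, dif_pos h1, dif_pos h2]
    rfl
  simp only [hq]
  rw [hpv] at hs
  rw [descents_eq_sum, descents_eq_sum]
  obtain ⟨r, hr⟩ := Nat.exists_eq_add_of_lt q.isLt
  have e1 : range (m + 1) = range (q + 1 + 1 + r) := by congr 1; omega
  have e2 : range m = range (q + 1 + r) := by congr 1; omega
  rw [e1, e2, sum_range_add _ (q + 1 + 1) r, sum_range_add _ (q + 1) r,
    sum_range_succ, sum_range_succ, sum_range_succ]
  have hA : ∑ i ∈ range (q : ℕ),
      (if permSeq (insertLast p π) (i + 1) < permSeq (insertLast p π) i then 1 else 0) =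
      ∑ i ∈ range (q : ℕ), if permSeq π (i + 1) < permSeq π i then 1 else 0 := by
    refine sum_congr rfl fun i hi => ?_
    have := mem_range.1 hi
    rw [hlo _ (by omega), hlo _ (by omega)]
  have hB : ∑ i ∈ range r, (if permSeq (insertLast p π) (q + 1 + 1 + i + 1) <
        permSeq (insertLast p π) (q + 1 + 1 + i) then 1 else 0) =
      ∑ i ∈ range r, if permSeq π (q + 1 + i + 1) < permSeq π (q + 1 + i) then 1 else 0 := by
    refine sum_congr rfl fun i _ => ?_
    rw [show (q : ℕ) + 1 + 1 + i = q + 1 + i + 1 by omega, hl _ (by omega), hl _ (by omega)]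
  have hlt := permSeq_lt π q
  have hlt' := permSeq_lt π (q + 1)
  rw [hA, hB, hs, hl _ le_rfl, hlo _ (Nat.lt_succ_self _), if_neg (by omega), if_pos hlt']
  split_ifs <;> omega

theorem sum_descents_insertLast {R : Type*} [CommSemiring R] {m : ℕ} (f : ℕ → R)
    (π : Equiv.Perm (Fin (m + 1))) :
    ∑ p, f (descents (insertLast p π)) =
      (descents π + 1 : ℕ) * f (descents π) + (m + 1 - descents π : ℕ) * f (descents π + 1) := by
  have hd : #{q : Fin m | π q.succ < π q.castSucc} = descents π := rfl
  have hd' : #{q : Fin m | ¬ π q.succ < π q.castSucc} = m - descents π := by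
    have := card_filter_add_card_filter_not (s := (univ : Finset (Fin m)))
      (fun q => π q.succ < π q.castSucc)
    rw [card_univ, Fintype.card_fin, hd] at this
    omega
  rw [Fin.sum_univ_castSucc, Fin.sum_univ_succ, Fin.castSucc_zero, descents_insertLast_zero,
    descents_insertLast_last]
  simp only [descents_insertLast_castSucc_succ, apply_ite f]
  rw [sum_ite, sum_const, sum_const, hd, hd', Nat.sub_add_comm (descents_le π)]
  push_cast
  simp only [nsmul_eq_mul]
  ring

theorem sum_perm_succ_descents {R : Type*} [CommSemiring R] (m : ℕ) (f : ℕ → R) :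
    ∑ π : Equiv.Perm (Fin (m + 2)), f (descents π) =
      ∑ π : Equiv.Perm (Fin (m + 1)), ((descents π + 1 : ℕ) * f (descents π) +
        (m + 1 - descents π : ℕ) * f (descents π + 1)) := by
  rw [← (insertLast_bijective (m + 1)).sum_comp (fun π => f (descents π)), Fintype.sum_prod_type,
    sum_comm]
  exact sum_congr rfl fun π _ => sum_descents_insertLast f π

theorem stirling_eq_zero_of_lt {n k : ℕ} (h : n < k) : stirling n k = 0 := by
  induction n generalizing k with
  | zero => obtain ⟨k, rfl⟩ := Nat.exists_eq_succ_of_ne_zero h.ne'; rfl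
  | succ n ih =>
    obtain ⟨k, rfl⟩ := Nat.exists_eq_succ_of_ne_zero (Nat.ne_zero_of_lt h)
    simp [stirling, ih (show n < k by omega), ih (show n < k + 1 by omega)]

/-- The polynomial counting ordered set partitions of an `n`-set by number of blocks. -/
noncomputable def fubiniPoly (n : ℕ) : ℝ[X] :=
  ∑ k ∈ range (n + 1), (stirling n k * k.factorial : ℝ[X]) * X ^ k

theorem fubiniPoly_succ (n : ℕ) :
    fubiniPoly (n + 1) = X * derivative ((X + 1) * fubiniPoly n) := by
  have hshift : ∑ k ∈ range (n + 1),
      (stirling n (k + 1) * (k + 1).factorial * (k + 1 : ℕ) : ℝ[X]) * X ^ (k + 1) =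
      ∑ k ∈ range (n + 1), (stirling n k * k.factorial * k : ℝ[X]) * X ^ k := by
    have h := sum_range_succ'
      (fun k => (stirling n k * k.factorial * k : ℝ[X]) * X ^ k) (n + 1)
    rw [sum_range_succ, stirling_eq_zero_of_lt (Nat.lt_succ_self n)] at h
    simpa using h.symm
  have hL : fubiniPoly (n + 1) = ∑ k ∈ range (n + 1),
      ((stirling n k * k.factorial * k : ℝ[X]) * X ^ k +
        (stirling n k * (k + 1).factorial : ℝ[X]) * X ^ (k + 1)) := by
    rw [sum_add_distrib, ← hshift, ← sum_add_distrib, fubiniPoly, sum_range_succ']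
    simp only [stirling, Nat.cast_zero, zero_mul, add_zero]
    refine sum_congr rfl fun k _ => ?_
    push_cast
    ring
  rw [hL, fubiniPoly, mul_sum, derivative_sum, mul_sum]
  refine sum_congr rfl fun k _ => ?_
  rw [show ((X : ℝ[X]) + 1) * ((stirling n k : ℝ[X]) * (k.factorial : ℝ[X]) * X ^ k) =
    ((stirling n k * k.factorial : ℕ) : ℝ[X]) * (X ^ (k + 1) + X ^ k) by push_cast; ring]
  rw [derivative_natCast_mul, derivative_add, derivative_X_pow, derivative_X_pow]
  cases k <;> simp [Nat.factorial_succ] <;> ring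

theorem sum_perm_pow_descents_eq_fubiniPoly (m : ℕ) :
    ∑ π : Equiv.Perm (Fin (m + 1)), (X : ℝ[X]) ^ (1 + descents π) * (X + 1) ^ (m - descents π) =
      fubiniPoly (m + 1) := by
  induction m with
  | zero =>
    have h (π : Equiv.Perm (Fin 1)) : descents π = 0 := Nat.le_zero.1 (descents_le π)
    simp [h, fubiniPoly, sum_range_succ, stirling]
  | succ m ih =>
    rw [sum_perm_succ_descents m (fun d => (X : ℝ[X]) ^ (1 + d) * (X + 1) ^ (m + 1 - d)),
      fubiniPoly_succ, ← ih, mul_sum, derivative_sum, mul_sum]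
    refine sum_congr rfl fun π _ => ?_
    obtain ⟨e, he⟩ := Nat.exists_eq_add_of_le (descents_le π)
    generalize descents π = d at he ⊢
    subst he
    rw [show d + e + 1 - d = e + 1 by omega, show d + e + 1 - (d + 1) = e by omega,
      show d + e - d = e by omega]
    rw [show ((X : ℝ[X]) + 1) * (X ^ (1 + d) * (X + 1) ^ e) = X ^ (d + 1) * (X + 1) ^ (e + 1) by
      ring]
    rw [derivative_mul, derivative_X_pow, derivative_pow]
    simp
    ring

end

/-- For `n ≥ 1` and real `α ∉ {0, −1}`,
`((α+1)^n / α) · A_n(α/(α+1)) = ∑_{k=1}^{n} S(n,k)·k!·α^{k−1}`,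
where `A_n(x) = ∑_{π ∈ S_n} x^{1+d(π)}` is the Eulerian polynomial. -/
theorem stmt1 (n : ℕ) (hn : 1 ≤ n) (α : ℝ) (h0 : α ≠ 0) (h1 : α ≠ -1) :
    ((α + 1) ^ n / α) *
        ∑ π : Equiv.Perm (Fin n), (α / (α + 1)) ^ (1 + descents π)
      = ∑ k ∈ Finset.Icc 1 n,
          (stirling n k * Nat.factorial k : ℝ) * α ^ (k - 1) := by
  obtain ⟨m, rfl⟩ := Nat.exists_eq_add_of_le' hn
  have h2 : α + 1 ≠ 0 := fun h => h1 (by linarith)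
  have h := congrArg (Polynomial.eval α) (sum_perm_pow_descents_eq_fubiniPoly m)
  simp only [fubiniPoly, Polynomial.eval_finsetSum, Polynomial.eval_mul, Polynomial.eval_pow,
    Polynomial.eval_X, Polynomial.eval_add, Polynomial.eval_one, Polynomial.eval_natCast] at h
  apply mul_left_cancel₀ h0
  calc
    _ = ∑ π : Equiv.Perm (Fin (m + 1)), α ^ (1 + descents π) * (α + 1) ^ (m - descents π) := by
      rw [← mul_assoc, Finset.mul_sum]
      refine Finset.sum_congr rfl fun π _ => ?_
      obtain ⟨e, he⟩ := Nat.exists_eq_add_of_le (descents_le π)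
      generalize descents π = d at he ⊢
      subst he
      rw [Nat.add_sub_cancel_left, div_pow]
      field_simp
      ring
    _ = _ := by
      rw [h, Finset.mul_sum, Finset.range_eq_Ico, Finset.sum_eq_sum_Ico_succ_bot (by omega)]
      simp only [stirling, Nat.cast_zero, zero_mul, zero_add]
      refine Finset.sum_congr (by ext; simp) fun k hk => ?_
      obtain ⟨j, rfl⟩ := Nat.exists_eq_add_of_le' (Finset.mem_Icc.1 hk).1
      rw [Nat.add_sub_cancel, pow_succ]
      ring
end

section
/- Fix integers α ≥ 1 and a color β ∈ {1,…,α}, and for n ≥ 1, m ≥ 0 let A^α(n,m) denote the number of α-colored permutations of [n] with last color β having exactly m descents (with the convention A^α(n,m) = 0 for m < 0). Then for all n ≥ 2 and k ≥ 0 the α-colored Eulerian numbers satisfy the three-term recurrence A^α(n,k) = (k+1)·A^α(n−1,k) + (α + n − k − 1 + k(α−1))·A^α(n−1,k−1) + (α−1)(n−k)·A^α(n−1,k−2). -/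
/-- The number of descents of an `A`-colored permutation `(w, c)` of `Fin N`:
positions `i` where `w(i) > w(i+1)` or `c(i) ≠ c(i+1)`. -/
def coloredDescents {N A : ℕ} (w : Equiv.Perm (Fin N)) (c : Fin N → Fin A) : ℕ :=
  (Finset.univ.filter fun i : Fin (N - 1) =>
    w (finHi i) < w (finLo i) ∨ c (finLo i) ≠ c (finHi i)).card

/-- The `A`-colored permutations of `Fin N` with last color `β`: pairs `(w, c)`
of a permutation `w` and a coloring `c` whose last value is `β`. -/
def coloredPerms (N A : ℕ) (β : Fin A) :
    Finset (Equiv.Perm (Fin N) × (Fin N → Fin A)) :=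
  Finset.univ.filter fun τ => ∀ h : N - 1 < N, τ.2 ⟨N - 1, h⟩ = β

/-- The `α`-colored Eulerian number `A^α(n,m)` for an integer index `m`:
the number of `α`-colored permutations of `[n]` with last color `β` having
exactly `m` descents, with the convention that it vanishes for `m < 0`. -/
def coloredEulerianZ (n A : ℕ) (β : Fin A) (m : ℤ) : ℕ :=
  if 0 ≤ m then
    ((coloredPerms n A β).filter fun τ => coloredDescents τ.1 τ.2 = m.toNat).card
  else 0

/-- The permutation obtained from `w` by inserting a new maximal value at position `p`. -/
def insertMax {N : ℕ} (p : Fin (N + 1)) (w : Equiv.Perm (Fin N)) : Equiv.Perm (Fin (N + 1)) :=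
  ((finSuccEquiv' p).trans (Equiv.optionCongr w)).trans (finSuccEquiv' (Fin.last N)).symm

theorem insertMax_self {N : ℕ} (p : Fin (N + 1)) (w : Equiv.Perm (Fin N)) :
    insertMax p w p = Fin.last N := by
  simp [insertMax]

theorem insertMax_succAbove {N : ℕ} (p : Fin (N + 1)) (w : Equiv.Perm (Fin N)) (i : Fin N) :
    insertMax p w (p.succAbove i) = (w i).castSucc := by
  simp [insertMax]

theorem insertMax_bijective (N : ℕ) :
    Function.Bijective fun x : Fin (N + 1) × Equiv.Perm (Fin N) => insertMax x.1 x.2 := by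
  rw [Fintype.bijective_iff_injective_and_card]
  refine ⟨?_, by simp [Fintype.card_perm, Nat.factorial_succ]⟩
  rintro ⟨p, w⟩ ⟨q, v⟩ h
  simp only at h
  have hpq : p = q := by
    apply (insertMax q v).injective
    rw [insertMax_self, ← h, insertMax_self]
  subst hpq
  simp only [Prod.mk.injEq, true_and]
  ext i : 1
  apply Fin.castSucc_injective
  rw [← insertMax_succAbove p, h, insertMax_succAbove]

/-- The indicator of a descent of the colored permutation `(w, c)` between two positions. -/
def descentIndicator {N A : ℕ} (w : Equiv.Perm (Fin N)) (c : Fin N → Fin A) (i j : Fin N) : ℕ :=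
  if w j < w i ∨ c i ≠ c j then 1 else 0

theorem coloredDescents_eq_sum {M A : ℕ} (w : Equiv.Perm (Fin (M + 1)))
    (c : Fin (M + 1) → Fin A) :
    coloredDescents w c = ∑ i : Fin M, descentIndicator w c i.castSucc i.succ :=
  Finset.card_filter _ _

section Insertion

variable {N A : ℕ} (p : Fin (N + 1)) (w : Equiv.Perm (Fin N)) (x : Fin A) (c : Fin N → Fin A)

theorem descentIndicator_insert_left (i : Fin N) :
    descentIndicator (insertMax p w) (p.insertNth x c) p (p.succAbove i) = 1 := by
  simp [descentIndicator, insertMax_self, insertMax_succAbove, Fin.castSucc_lt_last]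

theorem descentIndicator_insert_right (i : Fin N) :
    descentIndicator (insertMax p w) (p.insertNth x c) (p.succAbove i) p =
      if x = c i then 0 else 1 := by
  have h : ¬ Fin.last N < (w i).castSucc := not_lt.2 (Fin.le_last _)
  simp [descentIndicator, insertMax_self, insertMax_succAbove, h, eq_comm, ite_not]

theorem descentIndicator_insert_of_succAbove (i j : Fin N) :
    descentIndicator (insertMax p w) (p.insertNth x c) (p.succAbove i) (p.succAbove j) =
      descentIndicator w c i j := by
  simp [descentIndicator, insertMax_succAbove]

end Insertion

section Positions

variable {M A : ℕ} (w : Equiv.Perm (Fin (M + 1))) (x : Fin A) (c : Fin (M + 1) → Fin A)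

theorem coloredDescents_insert_zero :
    coloredDescents (insertMax 0 w) ((0 : Fin (M + 2)).insertNth (α := fun _ => Fin A) x c) =
      coloredDescents w c + 1 := by
  rw [coloredDescents_eq_sum, coloredDescents_eq_sum, Fin.sum_univ_succ, add_comm]
  congr 1
  · refine Finset.sum_congr rfl fun i _ => ?_
    exact descentIndicator_insert_of_succAbove 0 w x c i.castSucc i.succ
  · exact descentIndicator_insert_left 0 w x c 0

theorem coloredDescents_insert_last :
    coloredDescents (insertMax (Fin.last (M + 1)) w)
        ((Fin.last (M + 1)).insertNth (α := fun _ => Fin A) x c) =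
      if x = c (Fin.last M) then coloredDescents w c else coloredDescents w c + 1 := by
  rw [coloredDescents_eq_sum, coloredDescents_eq_sum, Fin.sum_univ_castSucc]
  have h := descentIndicator_insert_right (Fin.last (M + 1)) w x c (Fin.last M)
  have h' := fun i : Fin M =>
    descentIndicator_insert_of_succAbove (Fin.last (M + 1)) w x c i.castSucc i.succ
  simp only [Fin.succAbove_last, ← Fin.succ_castSucc] at h h'
  rw [Finset.sum_congr rfl fun i _ => h' i, Fin.succ_last, h]
  split_ifs <;> rfl

theorem coloredDescents_insert_succ (j : Fin M) :
    coloredDescents (insertMax j.castSucc.succ w)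
          (j.castSucc.succ.insertNth (α := fun _ => Fin A) x c) +
        descentIndicator w c j.castSucc j.succ =
      if x = c j.castSucc then coloredDescents w c + 1 else coloredDescents w c + 2 := by
  set p : Fin (M + 2) := j.castSucc.succ with hp
  have gap_right : j.succ.castSucc = p ∧ j.succ.succ = p.succAbove j.succ := by
    simp [Fin.succAbove, hp]
  have gap_left : j.castSucc.castSucc = p.succAbove j.castSucc ∧ j.castSucc.succ = p := by
    simp [Fin.succAbove, hp]
  have gap_other (i : Fin M) (hi : i ≠ j) :
      (j.succ.succAbove i).castSucc = p.succAbove i.castSucc ∧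
        (j.succ.succAbove i).succ = p.succAbove i.succ := by
    have hi' : i.val ≠ j.val := fun h => hi (Fin.ext h)
    simp only [Fin.ext_iff, Fin.succAbove, Fin.lt_def, hp, Fin.val_castSucc, Fin.val_succ,
      apply_ite Fin.val, true_and]
    split_ifs <;> omega
  have key (i : Fin M) :
      descentIndicator (insertMax p w) (p.insertNth x c)
        (j.succ.succAbove i).castSucc (j.succ.succAbove i).succ +
          (if i = j then descentIndicator w c j.castSucc j.succ else 0) =
        descentIndicator w c i.castSucc i.succ +
          if i = j then (if x = c j.castSucc then 0 else 1) else 0 := by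
    by_cases hi : i = j
    · subst hi
      rw [Fin.succAbove_succ_self, gap_left.1, gap_left.2,
        descentIndicator_insert_right, if_pos rfl, if_pos rfl, add_comm]
    · rw [(gap_other i hi).1, (gap_other i hi).2, descentIndicator_insert_of_succAbove, if_neg hi, if_neg hi]
  have total := Finset.sum_congr (rfl : (Finset.univ : Finset (Fin M)) = _) fun i _ => key i
  rw [Finset.sum_add_distrib, Finset.sum_add_distrib, Finset.sum_ite_eq' _ j,
    Finset.sum_ite_eq' _ j, if_pos (Finset.mem_univ _), if_pos (Finset.mem_univ _)] at total
  rw [coloredDescents_eq_sum, coloredDescents_eq_sum, Fin.sum_univ_succAbove _ j.succ, gap_right.1,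
    gap_right.2, descentIndicator_insert_left, add_assoc, total]
  split_ifs <;> omega

end Positions

theorem sum_ite_eq_fin {A : ℕ} (g : ℕ → ℤ) (a : Fin A) (u v : ℕ) :
    ∑ x : Fin A, g (if x = a then u else v) = g u + ((A : ℤ) - 1) * g v := by
  have h (x : Fin A) : g (if x = a then u else v) = (if x = a then g u - g v else 0) + g v := by
    split_ifs <;> simp
  simp_rw [h, Finset.sum_add_distrib]
  simp
  ring

theorem sum_insertions {M A : ℕ} (g : ℕ → ℤ) (w : Equiv.Perm (Fin (M + 1)))
    (c : Fin (M + 1) → Fin A) (d : ℕ) (hd : coloredDescents w c = d) :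
    ∑ p : Fin (M + 2), ∑ x : Fin A,
        g (coloredDescents (insertMax p w) (p.insertNth (α := fun _ => Fin A) x c)) =
      ((d : ℤ) + 1) * g d + (2 * A - 1 + M - d + d * ((A : ℤ) - 1)) * g (d + 1) +
        ((A : ℤ) - 1) * (M - d) * g (d + 2) := by
  have middle (j : Fin M) : ∑ x : Fin A,
      g (coloredDescents (insertMax j.castSucc.succ w)
        (j.castSucc.succ.insertNth (α := fun _ => Fin A) x c)) =
      g (d + 1) + (A - 1) * g (d + 2) + (descentIndicator w c j.castSucc j.succ : ℤ) *
        (g d + (A - 1) * g (d + 1) - (g (d + 1) + (A - 1) * g (d + 2))) := by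
    have h := fun x => coloredDescents_insert_succ w x c j
    rw [hd] at h
    have hle : descentIndicator w c j.castSucc j.succ = 0 ∨
        descentIndicator w c j.castSucc j.succ = 1 := by
      unfold descentIndicator; split_ifs <;> simp
    rcases hle with h0 | h1
    · simp only [h0, add_zero] at h
      simp_rw [h, sum_ite_eq_fin, h0]
      simp
    · have h' (x : Fin A) : coloredDescents (insertMax j.castSucc.succ w)
          (j.castSucc.succ.insertNth (α := fun _ => Fin A) x c) =
          if x = c j.castSucc then d else d + 1 := by
        have := h x
        split_ifs at this ⊢ <;> omega
      simp_rw [h', sum_ite_eq_fin, h1]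
      simp
  rw [Fin.sum_univ_succ, Fin.sum_univ_castSucc]
  simp_rw [coloredDescents_insert_zero, Fin.succ_last, coloredDescents_insert_last, hd,
    sum_ite_eq_fin, middle]
  rw [Finset.sum_add_distrib, ← Finset.sum_mul, ← Nat.cast_sum, ← coloredDescents_eq_sum, hd]
  simp
  ring

/-- The number of `A`-colored permutations of `Fin N`, with arbitrary last color, having exactly
`m` descents. -/
def coloredTotal (N A : ℕ) (m : ℤ) : ℤ :=
  ∑ w : Equiv.Perm (Fin N), ∑ c : Fin N → Fin A, if (coloredDescents w c : ℤ) = m then 1 else 0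

theorem sum_coloredDescents_succ (M A : ℕ) (g : ℕ → ℤ) :
    ∑ w : Equiv.Perm (Fin (M + 2)), ∑ c : Fin (M + 2) → Fin A, g (coloredDescents w c) =
      ∑ w : Equiv.Perm (Fin (M + 1)), ∑ c : Fin (M + 1) → Fin A,
        ∑ p : Fin (M + 2), ∑ x : Fin A,
          g (coloredDescents (insertMax p w) (p.insertNth (α := fun _ => Fin A) x c)) := by
  rw [← (insertMax_bijective (M + 1)).sum_comp
    (fun w => ∑ c : Fin (M + 2) → Fin A, g (coloredDescents w c)), Fintype.sum_prod_type,
    Finset.sum_comm]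
  refine Finset.sum_congr rfl fun w _ => ?_
  have h (p : Fin (M + 2)) : ∑ c : Fin (M + 2) → Fin A, g (coloredDescents (insertMax p w) c) =
      ∑ c : Fin (M + 1) → Fin A, ∑ x : Fin A,
        g (coloredDescents (insertMax p w) (p.insertNth (α := fun _ => Fin A) x c)) := by
    rw [← (Fin.insertNthEquiv (fun _ => Fin A) p).sum_comp, Fintype.sum_prod_type,
      Finset.sum_comm]
    rfl
  simp_rw [h]
  exact Finset.sum_comm

theorem coloredTotal_succ (M A : ℕ) (m : ℤ) :
    coloredTotal (M + 2) A m =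
      (m + 1) * coloredTotal (M + 1) A m +
        (A + (M + 2) - m - 1 + m * ((A : ℤ) - 1)) * coloredTotal (M + 1) A (m - 1) +
        ((A : ℤ) - 1) * ((M + 2) - m) * coloredTotal (M + 1) A (m - 2) := by
  unfold coloredTotal
  rw [sum_coloredDescents_succ M A fun d => if (d : ℤ) = m then 1 else 0]
  simp_rw [Finset.mul_sum, ← Finset.sum_add_distrib]
  refine Finset.sum_congr rfl fun w _ => Finset.sum_congr rfl fun c _ => ?_
  rw [sum_insertions (fun d => if (d : ℤ) = m then 1 else 0) w c _ rfl]
  generalize coloredDescents w c = d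
  push_cast
  congr 1
  · congr 1
    · split_ifs with h
      · rw [h]
      · simp
    · by_cases h : (d : ℤ) + 1 = m
      · subst h
        simp
        ring
      · simp [h, show (d : ℤ) ≠ m - 1 by omega]
  · by_cases h : (d : ℤ) + 2 = m
    · subst h
      simp
    · simp [h, show (d : ℤ) ≠ m - 2 by omega]

theorem coloredEulerianZ_eq_sum (M A : ℕ) (β : Fin A) (m : ℤ) :
    (coloredEulerianZ (M + 1) A β m : ℤ) =
      ∑ w : Equiv.Perm (Fin (M + 1)), ∑ c : Fin (M + 1) → Fin A,
        if c (Fin.last M) = β then (if (coloredDescents w c : ℤ) = m then 1 else 0) else 0 := by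
  rw [← Fintype.sum_prod_type' (f := fun (w : Equiv.Perm (Fin (M + 1)))
    (c : Fin (M + 1) → Fin A) =>
      if c (Fin.last M) = β then (if (coloredDescents w c : ℤ) = m then (1 : ℤ) else 0) else 0)]
  have hlast (τ : Equiv.Perm (Fin (M + 1)) × (Fin (M + 1) → Fin A)) :
      (∀ h : M + 1 - 1 < M + 1, τ.2 ⟨M + 1 - 1, h⟩ = β) ↔ τ.2 (Fin.last M) = β :=
    ⟨fun h => h (by omega), fun h _ => h⟩
  unfold coloredEulerianZ coloredPerms
  split_ifs with hm
  · rw [Finset.filter_filter, Finset.card_filter, Nat.cast_sum]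
    refine Finset.sum_congr rfl fun τ _ => ?_
    have hd : coloredDescents τ.1 τ.2 = m.toNat ↔ (coloredDescents τ.1 τ.2 : ℤ) = m := by omega
    simp only [hlast, hd, ite_and]
    split_ifs <;> rfl
  · refine (Finset.sum_eq_zero fun τ _ => ?_).symm
    rw [if_neg (show (coloredDescents τ.1 τ.2 : ℤ) ≠ m by omega), ite_self]

theorem coloredDescents_comp {N A : ℕ} (w : Equiv.Perm (Fin N)) (c : Fin N → Fin A)
    (σ : Equiv.Perm (Fin A)) : coloredDescents w (σ ∘ c) = coloredDescents w c := by
  simp [coloredDescents]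

theorem coloredEulerianZ_color_eq (M A : ℕ) (β γ : Fin A) (m : ℤ) :
    (coloredEulerianZ (M + 1) A γ m : ℤ) = coloredEulerianZ (M + 1) A β m := by
  rw [coloredEulerianZ_eq_sum, coloredEulerianZ_eq_sum]
  refine Finset.sum_congr rfl fun w _ => ?_
  rw [← (Equiv.arrowCongr (Equiv.refl (Fin (M + 1))) (Equiv.swap β γ)).sum_comp]
  refine Finset.sum_congr rfl fun c _ => ?_
  have h : Equiv.arrowCongr (Equiv.refl (Fin (M + 1))) (Equiv.swap β γ) c =
    Equiv.swap β γ ∘ c := rfl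
  have h' : Equiv.swap β γ (c (Fin.last M)) = γ ↔ c (Fin.last M) = β := by
    rw [← Equiv.eq_symm_apply, Equiv.symm_swap, Equiv.swap_apply_right]
  simp only [h, coloredDescents_comp, Function.comp_apply, h']

theorem card_mul_coloredEulerianZ (M A : ℕ) (β : Fin A) (m : ℤ) :
    (A : ℤ) * coloredEulerianZ (M + 1) A β m = coloredTotal (M + 1) A m := by
  calc (A : ℤ) * coloredEulerianZ (M + 1) A β m
      = ∑ γ : Fin A, (coloredEulerianZ (M + 1) A γ m : ℤ) := by
        simp [coloredEulerianZ_color_eq M A β]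
    _ = coloredTotal (M + 1) A m := by
        simp_rw [coloredEulerianZ_eq_sum]
        rw [Finset.sum_comm]
        refine Finset.sum_congr rfl fun w _ => ?_
        rw [Finset.sum_comm]
        refine Finset.sum_congr rfl fun c _ => ?_
        rw [Finset.sum_ite_eq, if_pos (Finset.mem_univ _)]

/-- Recurrence for the `α`-colored Eulerian numbers: for `n ≥ 2` and `k ≥ 0`,
`A^α(n,k) = (k+1)·A^α(n−1,k) + (α+n−k−1+k(α−1))·A^α(n−1,k−1)
  + (α−1)(n−k)·A^α(n−1,k−2)`. -/
theorem stmt15 (A : ℕ) (hA : 1 ≤ A) (β : Fin A) (n : ℕ) (hn : 2 ≤ n) (k : ℕ) :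
    (coloredEulerianZ n A β k : ℤ)
      = ((k : ℤ) + 1) * coloredEulerianZ (n - 1) A β k
        + ((A : ℤ) + n - k - 1 + k * ((A : ℤ) - 1)) *
            coloredEulerianZ (n - 1) A β ((k : ℤ) - 1)
        + ((A : ℤ) - 1) * ((n : ℤ) - k) *
            coloredEulerianZ (n - 1) A β ((k : ℤ) - 2) := by
  obtain ⟨M, rfl⟩ := Nat.exists_eq_add_of_le' hn
  have hA' : (A : ℤ) ≠ 0 := by omega
  apply mul_left_cancel₀ hA'
  have h := coloredTotal_succ M A k
  simp only [← card_mul_coloredEulerianZ _ A β] at h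
  rw [card_mul_coloredEulerianZ (M + 1) A β, ← card_mul_coloredEulerianZ (M + 1) A β, h]
  rw [show M + 2 - 1 = M + 1 from rfl]
  push_cast
  ring
end
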